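/- Higher integrability of the density (Lemma 3.5): Let (ρ,u,b⁻,b⁺) be a classical solution of the viscous free-boundary problem on [0,T] with 0 ≤ α ≤ γ and ε ∈ (0,1]. Assume the uniform bounds: ∫_{b⁻(t)}^{b⁺(t)} ρ(t,x) dx = M for all t; ∫_{b⁻(t)}^{b⁺(t)} (½ρu² + ρe(ρ)) (t,x) dx + ε ∫_0^T ∫_{b⁻(s)}^{b⁺(s)} ρ^α (u_x)² dx ds ≤ C₀ for all t ∈ [0,T]; ∫_{b⁻(t)}^{b⁺(t)} x² ρ(t,x) dx ≤ C₀ for all t; ε ∫_0^T ∫_{b⁻(s)}^{b⁺(s)} ρ^{α+γ−3} (ρ_x)² dx ds ≤ C₀; |λ| ≤ C₀ and ‖ϖ‖_{L^∞} ≤ C₀. Let r₁ < r₂ be such that [r₁,r₂] ⊂ (b⁻(t), b⁺(t)) for all t ∈ [0,T]. Then there exists a constant C > 0, depending only on C₀, M, r₁, r₂, T, γ, α, and κ and not on ε, such that ∫_0^T ∫_{r₁}^{r₂} ρ^{γ+1}(t,x) dx dt ≤ C. -/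

import Mathlib

open Real MeasureTheory Set

/-- The integral over a rectangle of a continuous divergence `∂ₜA + ∂ₛB` is the flux through the
sides; only the two partial derivatives that occur in it need to exist. -/
theorem integral_divergence_rectangle {t₀ t₁ s₀ s₁ : ℝ} (ht : t₀ ≤ t₁) (hs : s₀ ≤ s₁)
    {A A' B B' : ℝ → ℝ → ℝ}
    (hA : Continuous fun p : ℝ × ℝ => A p.1 p.2) (hA' : Continuous fun p : ℝ × ℝ => A' p.1 p.2)
    (hB : Continuous fun p : ℝ × ℝ => B p.1 p.2) (hB' : Continuous fun p : ℝ × ℝ => B' p.1 p.2)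
    (hAd : ∀ t ∈ Ioo t₀ t₁, ∀ s ∈ Ioo s₀ s₁, HasDerivAt (fun τ => A τ s) (A' t s) t)
    (hBd : ∀ t ∈ Ioo t₀ t₁, ∀ s ∈ Ioo s₀ s₁, HasDerivAt (fun σ => B t σ) (B' t s) s) :
    (∫ t in t₀..t₁, ∫ s in s₀..s₁, (A' t s + B' t s))
      = (∫ s in s₀..s₁, (A t₁ s - A t₀ s)) + ∫ t in t₀..t₁, (B t s₁ - B t s₀) := by
  have cA : ∀ s, Continuous fun τ => A τ s := fun s => hA.comp (.prodMk_left s)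
  have cA' : ∀ s, Continuous fun τ => A' τ s := fun s => hA'.comp (.prodMk_left s)
  have cA's : ∀ t, Continuous fun σ => A' t σ := fun s => hA'.comp (.prodMk_right s)
  have cB : ∀ t, Continuous fun σ => B t σ := fun s => hB.comp (.prodMk_right s)
  have cB' : ∀ t, Continuous fun σ => B' t σ := fun s => hB'.comp (.prodMk_right s)
  have iA : Continuous fun t => ∫ s in s₀..s₁, A' t s :=
    intervalIntegral.continuous_parametric_intervalIntegral_of_continuous' (f := A') hA' _ _
  have iB : Continuous fun t => ∫ s in s₀..s₁, B' t s :=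
    intervalIntegral.continuous_parametric_intervalIntegral_of_continuous' (f := B') hB' _ _
  have split : ∀ t, (∫ s in s₀..s₁, (A' t s + B' t s))
      = (∫ s in s₀..s₁, A' t s) + ∫ s in s₀..s₁, B' t s := fun t =>
    intervalIntegral.integral_add ((cA's t).intervalIntegrable _ _)
      ((cB' t).intervalIntegrable _ _)
  simp_rw [split]
  rw [intervalIntegral.integral_add (iA.intervalIntegrable _ _) (iB.intervalIntegrable _ _)]
  congr 1
  · have hswap : (∫ t in t₀..t₁, ∫ s in s₀..s₁, A' t s) = ∫ s in s₀..s₁, ∫ t in t₀..t₁, A' t s := by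
      simp only [intervalIntegral.integral_of_le hs, intervalIntegral.integral_of_le ht]
      refine integral_integral_swap ?_
      rw [Measure.prod_restrict]
      exact (hA'.continuousOn.integrableOn_compact (isCompact_Icc.prod isCompact_Icc)).mono_set
        (prod_mono Ioc_subset_Icc_self Ioc_subset_Icc_self)
    rw [hswap]
    refine intervalIntegral.integral_congr_Ioo_of_le hs fun s hs' => ?_
    exact intervalIntegral.integral_eq_sub_of_hasDerivAt_of_le ht (cA s).continuousOn
      (fun t ht' => hAd t ht' s hs') ((cA' s).intervalIntegrable _ _)
  · refine intervalIntegral.integral_congr_Ioo_of_le ht fun t ht' => ?_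
    exact intervalIntegral.integral_eq_sub_of_hasDerivAt_of_le hs (cB t).continuousOn
      (fun s hs' => hBd t ht' s hs') ((cB' t).intervalIntegrable _ _)

theorem hasDerivAt_integral_of_continuous {f : ℝ → ℝ} (hf : Continuous f) (a x : ℝ) :
    HasDerivAt (fun y => ∫ σ in a..y, f σ) (f x) x :=
  intervalIntegral.integral_hasDerivAt_right (hf.intervalIntegrable _ _)
    (hf.stronglyMeasurableAtFilter _ _) hf.continuousAt

/-- If `∂ₜr + ∂ₛJ = 0` and `J` vanishes at `s = 0`, the mass function `∫₀ˢ r` has time derivative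
`-J`. -/
theorem hasDerivAt_mass {T : ℝ} {r J J' : ℝ → ℝ → ℝ}
    (cr : Continuous fun p : ℝ × ℝ => r p.1 p.2) (cJ : Continuous fun p : ℝ × ℝ => J p.1 p.2)
    (cJ' : Continuous fun p : ℝ × ℝ => J' p.1 p.2)
    (hr : ∀ t ∈ Ioo 0 T, ∀ s ∈ Ioo (0:ℝ) 1, HasDerivAt (fun τ => r τ s) (-J' t s) t)
    (hJ : ∀ t ∈ Ioo 0 T, ∀ s ∈ Ioo (0:ℝ) 1, HasDerivAt (fun σ => J t σ) (J' t s) s)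
    (hJ0 : ∀ t, J t 0 = 0) {t s : ℝ} (ht : t ∈ Ioo 0 T) (hs : s ∈ Ioo (0:ℝ) 1) :
    HasDerivAt (fun τ => ∫ σ in (0:ℝ)..s, r τ σ) (-J t s) t := by
  have cr' : ∀ τ, Continuous fun σ => r τ σ := fun τ =>
    cr.comp (by fun_prop : Continuous fun σ : ℝ => (τ, σ))
  have key : ∀ τ ∈ Ioo 0 T, (∫ σ in (0:ℝ)..s, r τ σ)
      = (∫ σ in (0:ℝ)..s, r 0 σ) - ∫ τ' in (0:ℝ)..τ, J τ' s := by
    intro τ hτ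
    have h := integral_divergence_rectangle (t₀ := 0) (t₁ := τ) (s₀ := 0) (s₁ := s) hτ.1.le hs.1.le
      cr (A' := fun t s => -J' t s) (by fun_prop) cJ cJ'
      (fun t ht' σ hσ => hr t ⟨ht'.1, ht'.2.trans hτ.2⟩ σ ⟨hσ.1, hσ.2.trans hs.2⟩)
      (fun t ht' σ hσ => hJ t ⟨ht'.1, ht'.2.trans hτ.2⟩ σ ⟨hσ.1, hσ.2.trans hs.2⟩)
    rw [intervalIntegral.integral_sub ((cr' _).intervalIntegrable _ _)
      ((cr' _).intervalIntegrable _ _)] at h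
    simp only [neg_add_cancel, intervalIntegral.integral_zero, hJ0, sub_zero] at h
    linarith
  have hd := (hasDerivAt_integral_of_continuous
    (cJ.comp (by fun_prop : Continuous fun τ : ℝ => (τ, s))) 0 t).const_sub
    (∫ σ in (0:ℝ)..s, r 0 σ)
  refine hd.congr_of_eventuallyEq ?_
  filter_upwards [Ioo_mem_nhds ht.1 ht.2] with τ hτ using key τ hτ

/-- The momentum balance tested with the transported weight `M - ∫₀ˢ r`: the convective terms
cancel and the stress is weighted by the density. -/
theorem integral_mass_weighted_momentum {T : ℝ} (hT : 0 < T) (M : ℝ)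
    {r J J' v vt vs S S' F : ℝ → ℝ → ℝ}
    (cr : Continuous fun p : ℝ × ℝ => r p.1 p.2) (cJ : Continuous fun p : ℝ × ℝ => J p.1 p.2)
    (cJ' : Continuous fun p : ℝ × ℝ => J' p.1 p.2) (cv : Continuous fun p : ℝ × ℝ => v p.1 p.2)
    (cvt : Continuous fun p : ℝ × ℝ => vt p.1 p.2) (cvs : Continuous fun p : ℝ × ℝ => vs p.1 p.2)
    (cS : Continuous fun p : ℝ × ℝ => S p.1 p.2) (cS' : Continuous fun p : ℝ × ℝ => S' p.1 p.2)
    (hr : ∀ t ∈ Ioo 0 T, ∀ s ∈ Ioo (0:ℝ) 1, HasDerivAt (fun τ => r τ s) (-J' t s) t)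
    (hJ : ∀ t ∈ Ioo 0 T, ∀ s ∈ Ioo (0:ℝ) 1, HasDerivAt (fun σ => J t σ) (J' t s) s)
    (hvt : ∀ t ∈ Ioo 0 T, ∀ s ∈ Ioo (0:ℝ) 1, HasDerivAt (fun τ => v τ s) (vt t s) t)
    (hvs : ∀ t ∈ Ioo 0 T, ∀ s ∈ Ioo (0:ℝ) 1, HasDerivAt (fun σ => v t σ) (vs t s) s)
    (hS : ∀ t ∈ Ioo 0 T, ∀ s ∈ Ioo (0:ℝ) 1, HasDerivAt (fun σ => S t σ) (S' t s) s)
    (hF : ∀ t ∈ Ioo 0 T, ∀ s ∈ Ioo (0:ℝ) 1, r t s * vt t s + J t s * vs t s + S' t s = F t s)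
    (hJ0 : ∀ t, J t 0 = 0) (hJ1 : ∀ t, J t 1 = 0)
    (hS0 : ∀ t, S t 0 = 0) (hS1 : ∀ t, S t 1 = 0) :
    (∫ t in (0:ℝ)..T, ∫ s in (0:ℝ)..1,
        ((M - ∫ σ in (0:ℝ)..s, r t σ) * F t s - r t s * S t s))
      = ∫ s in (0:ℝ)..1, ((M - ∫ σ in (0:ℝ)..s, r T σ) * r T s * v T s
          - (M - ∫ σ in (0:ℝ)..s, r 0 σ) * r 0 s * v 0 s) := by
  have cμ : Continuous fun p : ℝ × ℝ => ∫ σ in (0:ℝ)..p.2, r p.1 σ :=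
    intervalIntegral.continuous_parametric_intervalIntegral_of_continuous
      (f := fun (p : ℝ × ℝ) σ => r p.1 σ)
      (cr.comp (by fun_prop : Continuous fun q : (ℝ × ℝ) × ℝ => (q.1.1, q.2))) continuous_snd
  have cr' : ∀ τ, Continuous fun σ => r τ σ := fun τ =>
    cr.comp (by fun_prop : Continuous fun σ : ℝ => (τ, σ))
  set μ : ℝ → ℝ → ℝ := fun t s => ∫ σ in (0:ℝ)..s, r t σ with hμ
  have h := integral_divergence_rectangle hT.le zero_le_one
    (A := fun t s => (M - μ t s) * r t s * v t s)
    (A' := fun t s => (J t s * r t s + (M - μ t s) * -J' t s) * v t s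
      + (M - μ t s) * r t s * vt t s)
    (B := fun t s => (M - μ t s) * (J t s * v t s + S t s))
    (B' := fun t s => -r t s * (J t s * v t s + S t s)
      + (M - μ t s) * (J' t s * v t s + J t s * vs t s + S' t s))
    (by fun_prop) (by fun_prop) (by fun_prop) (by fun_prop)
    (fun t ht s hs => by
      have hφ := (hasDerivAt_mass cr cJ cJ' hr hJ hJ0 ht hs).const_sub M
      rw [neg_neg] at hφ
      exact (hφ.mul (hr t ht s hs)).mul (hvt t ht s hs))
    (fun t ht s hs => by
      have hφ := (hasDerivAt_integral_of_continuous (cr' t) 0 s).const_sub M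
      exact hφ.mul (((hJ t ht s hs).mul (hvs t ht s hs)).add (hS t ht s hs)))
  simp only [hJ0, hJ1, hS0, hS1, zero_mul, add_zero, mul_zero, sub_zero,
    intervalIntegral.integral_zero] at h
  rw [← h]
  refine intervalIntegral.integral_congr_Ioo_of_le hT.le fun t ht => ?_
  refine intervalIntegral.integral_congr_Ioo_of_le zero_le_one fun s hs => ?_
  simp only [hμ, ← hF t ht s hs]
  ring

/-- A weighted Sobolev bound: mass `M` on an interval of length `L ≥ d`, together with
`∫ R ^ (p - 3) * Rₓ²`, controls `sup R ^ p` linearly. -/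
theorem rpow_le_of_mass_of_gradient {R Rx : ℝ → ℝ} {L d M p : ℝ} (hd : 0 < d) (hdL : d ≤ L)
    (hp : 0 < p) (hR : Continuous R) (hRx : Continuous Rx) (hpos : ∀ s, 0 < R s)
    (hderiv : ∀ s ∈ Ioo (0:ℝ) 1, HasDerivAt R (L * Rx s) s)
    (hM : ∫ s in (0:ℝ)..1, L * R s = M) {s : ℝ} (hs : s ∈ Icc (0:ℝ) 1) :
    R s ^ p ≤ 2 * (M / d) ^ p + p ^ 2 * M * ∫ s in (0:ℝ)..1, L * (R s ^ (p - 3) * Rx s ^ 2) := by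
  have hL : 0 < L := hd.trans_le hdL
  have crp : ∀ q : ℝ, Continuous fun s => R s ^ q := fun q =>
    hR.rpow_const fun s => Or.inl (hpos s).ne'
  have hMpos : 0 < M := by
    rw [← hM]
    exact intervalIntegral.intervalIntegral_pos_of_pos
      ((by fun_prop : Continuous fun s => L * R s).intervalIntegrable _ _)
      (fun s => mul_pos hL (hpos s)) zero_lt_one
  obtain ⟨a, ha, hmin⟩ := isCompact_Icc.exists_isMinOn (nonempty_Icc.2 zero_le_one)
    hR.continuousOn (s := Icc (0:ℝ) 1)
  obtain ⟨b, hb, hmax⟩ := isCompact_Icc.exists_isMaxOn (nonempty_Icc.2 zero_le_one)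
    hR.continuousOn (s := Icc (0:ℝ) 1)
  have hRa : R a ≤ M / d := by
    rw [le_div_iff₀ hd]
    have h1 : ∫ _ in (0:ℝ)..1, L * R a ≤ ∫ s in (0:ℝ)..1, L * R s := by
      refine intervalIntegral.integral_mono_on zero_le_one (by simp)
        ((by fun_prop : Continuous fun s => L * R s).intervalIntegrable _ _) fun x hx => ?_
      exact mul_le_mul_of_nonneg_left (hmin hx) hL.le
    rw [hM] at h1
    simp only [intervalIntegral.integral_const, sub_zero, one_smul] at h1
    nlinarith [hpos a]
  set Z := R b ^ p with hZ
  set D := ∫ s in (0:ℝ)..1, L * (R s ^ (p - 3) * Rx s ^ 2) with hD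
  have hsZ : ∀ x ∈ Icc (0:ℝ) 1, R x ^ p ≤ Z := fun x hx =>
    rpow_le_rpow (hpos x).le (hmax hx) hp.le
  have cg : Continuous fun x => L * Rx x * p * R x ^ (p - 1) := by fun_prop
  have hftc : ∀ x ∈ Icc (0:ℝ) 1, ∀ y ∈ Icc (0:ℝ) 1, x ≤ y →
      |R y ^ p - R x ^ p| ≤ ∫ s in (0:ℝ)..1, |L * Rx s * p * R s ^ (p - 1)| := by
    intro x hx y hy hxy
    rw [← intervalIntegral.integral_eq_sub_of_hasDerivAt_of_le hxy (crp p).continuousOn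
      (fun z hz => (hderiv z ⟨hx.1.trans_lt hz.1, hz.2.trans_le hy.2⟩).rpow_const
        (Or.inl (hpos z).ne')) (cg.intervalIntegrable _ _)]
    refine (intervalIntegral.abs_integral_le_integral_abs hxy).trans ?_
    exact intervalIntegral.integral_mono_interval hx.1 hxy hy.2
      (Filter.Eventually.of_forall fun _ => abs_nonneg _) (cg.abs.intervalIntegrable _ _)
  have hosc : R b ^ p - R a ^ p ≤ ∫ s in (0:ℝ)..1, |L * Rx s * p * R s ^ (p - 1)| := by
    rcases le_total a b with h | h
    · exact (le_abs_self _).trans (hftc a ha b hb h)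
    · exact (le_abs_self _).trans (abs_sub_comm (R a ^ p) _ ▸ hftc b hb a ha h)
  have hyoung : ∀ x ∈ Icc (0:ℝ) 1, |L * Rx x * p * R x ^ (p - 1)|
      ≤ Z / (2 * M) * (L * R x) + p ^ 2 * M / 2 * (L * (R x ^ (p - 3) * Rx x ^ 2)) := by
    intro x hx
    have hx0 := hpos x
    have hw : 0 < R x ^ (p - 3) := rpow_pos_of_pos hx0 _
    have e1 : R x ^ (p - 1) = R x ^ (p - 3) * R x ^ 2 := by
      rw [← rpow_natCast, ← rpow_add hx0]; norm_num; ring_nf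
    have e2 : R x ^ p = R x ^ (p - 3) * R x ^ 3 := by
      rw [← rpow_natCast, ← rpow_add hx0]; norm_num
    have h1 : |L * Rx x * p * R x ^ (p - 1)| = L * R x ^ (p - 3) * (R x ^ 2 * p * |Rx x|) := by
      rw [abs_mul, abs_mul, abs_mul, abs_of_pos hL, abs_of_pos hp,
        abs_of_pos (rpow_pos_of_pos hx0 _), e1]
      ring
    have h2 : R x ^ 2 * p * |Rx x| ≤ R x ^ 4 / (2 * M) + p ^ 2 * M / 2 * Rx x ^ 2 := by
      have : R x ^ 4 / (2 * M) + p ^ 2 * M / 2 * Rx x ^ 2 - R x ^ 2 * p * |Rx x|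
          = (R x ^ 2 - M * p * |Rx x|) ^ 2 / (2 * M) := by
        rw [← sq_abs (Rx x)]; field_simp; ring
      have : 0 ≤ (R x ^ 2 - M * p * |Rx x|) ^ 2 / (2 * M) := by positivity
      linarith
    have h3 : R x ^ p / (2 * M) * (L * R x) ≤ Z / (2 * M) * (L * R x) := by
      gcongr
      exact hsZ x hx
    calc _ = _ := h1
      _ ≤ L * R x ^ (p - 3) * (R x ^ 4 / (2 * M) + p ^ 2 * M / 2 * Rx x ^ 2) := by gcongr
      _ = R x ^ p / (2 * M) * (L * R x) + p ^ 2 * M / 2 * (L * (R x ^ (p - 3) * Rx x ^ 2)) := by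
        rw [e2]; ring
      _ ≤ _ := by linarith
  have hint : (∫ s in (0:ℝ)..1, |L * Rx s * p * R s ^ (p - 1)|) ≤ Z / 2 + p ^ 2 * M / 2 * D := by
    have c1 : Continuous fun x => Z / (2 * M) * (L * R x) := by fun_prop
    have c2 : Continuous fun x => p ^ 2 * M / 2 * (L * (R x ^ (p - 3) * Rx x ^ 2)) := by fun_prop
    have h := intervalIntegral.integral_mono_on (μ := volume) zero_le_one
      (cg.abs.intervalIntegrable _ _) ((c1.add c2).intervalIntegrable _ _) hyoung
    simp only [Pi.add_apply] at h
    rw [intervalIntegral.integral_add (μ := volume) (c1.intervalIntegrable _ _)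
        (c2.intervalIntegrable _ _),
      intervalIntegral.integral_const_mul (Z / (2 * M)),
      intervalIntegral.integral_const_mul (p ^ 2 * M / 2), hM, ← hD] at h
    have : Z / (2 * M) * M = Z / 2 := by field_simp
    linarith
  have hap : R a ^ p ≤ (M / d) ^ p := rpow_le_rpow (hpos a).le hRa hp.le
  have := hsZ s hs
  linarith

/-- The a priori estimate in coordinates where the fluid domain is `[0, 1]`: `L` is the length of
the domain, `R` the density, `v` the velocity, `q` its spatial derivative, `X` the position and
`F` the force. -/
theorem integral_rpow_le_of_mass_weighted_identity {γ κ α T C₀ M K d ε : ℝ} (hγ : 1 < γ)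
    (hα : 0 ≤ α) (hT : 0 < T) (hd : 0 < d) (hK : 0 ≤ K) (hε : ε ∈ Ioc (0:ℝ) 1)
    {L : ℝ → ℝ} {R Rx v q X F : ℝ → ℝ → ℝ} (cL : Continuous L)
    (cR : Continuous fun p : ℝ × ℝ => R p.1 p.2) (cRx : Continuous fun p : ℝ × ℝ => Rx p.1 p.2)
    (cv : Continuous fun p : ℝ × ℝ => v p.1 p.2) (cq : Continuous fun p : ℝ × ℝ => q p.1 p.2)
    (cX : Continuous fun p : ℝ × ℝ => X p.1 p.2) (cF : Continuous fun p : ℝ × ℝ => F p.1 p.2)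
    (hdL : ∀ t, d ≤ L t) (hR : ∀ t s, 0 < R t s)
    (hRx : ∀ t ∈ Icc 0 T, ∀ s ∈ Ioo (0:ℝ) 1, HasDerivAt (R t) (L t * Rx t s) s)
    (hF : ∀ t ∈ Icc 0 T, ∀ s ∈ Icc (0:ℝ) 1,
      |F t s| ≤ K * (L t * R t s + L t * (R t s * v t s ^ 2) + L t * (X t s ^ 2 * R t s)))
    (hmass : ∀ t ∈ Icc 0 T, ∫ s in (0:ℝ)..1, L t * R t s = M)
    (hkin : ∀ t ∈ Icc 0 T, ∫ s in (0:ℝ)..1, L t * (R t s * v t s ^ 2) ≤ 2 * C₀)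
    (hmom : ∀ t ∈ Icc 0 T, ∫ s in (0:ℝ)..1, L t * (X t s ^ 2 * R t s) ≤ C₀)
    (hdiss : ε * (∫ t in (0:ℝ)..T, ∫ s in (0:ℝ)..1, L t * (R t s ^ α * q t s ^ 2)) ≤ C₀)
    (hgrad : ε * (∫ t in (0:ℝ)..T, ∫ s in (0:ℝ)..1,
      L t * (R t s ^ (α + γ - 3) * Rx t s ^ 2)) ≤ C₀)
    (hid : (∫ t in (0:ℝ)..T, ∫ s in (0:ℝ)..1, ((M - ∫ σ in (0:ℝ)..s, L t * R t σ) * F t s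
        - L t * R t s * (κ * R t s ^ γ - ε * R t s ^ α * q t s)))
      = ∫ s in (0:ℝ)..1, ((M - ∫ σ in (0:ℝ)..s, L T * R T σ) * (L T * R T s) * v T s
          - (M - ∫ σ in (0:ℝ)..s, L 0 * R 0 σ) * (L 0 * R 0 s) * v 0 s)) :
    κ * (∫ t in (0:ℝ)..T, ∫ s in (0:ℝ)..1, L t * R t s ^ (γ + 1))
      ≤ M * (M + 2 * C₀) + T * (M * K * (M + 3 * C₀) + M / 2 * (1 + 2 * (M / d) ^ (α + γ)))
        + C₀ / 2 + (α + γ) ^ 2 * M ^ 2 / 2 * C₀ := by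
  have hL : ∀ t, 0 < L t := fun t => hd.trans_le (hdL t)
  have crp : ∀ p : ℝ, Continuous fun z : ℝ × ℝ => R z.1 z.2 ^ p := fun p =>
    cR.rpow_const fun z => Or.inl (hR _ _).ne'
  have param : ∀ f : ℝ → ℝ → ℝ, (Continuous fun p : ℝ × ℝ => f p.1 p.2) →
      (∀ t, Continuous (f t)) ∧ Continuous fun t => ∫ s in (0:ℝ)..1, f t s := fun f hf =>
    ⟨fun t => hf.comp (by fun_prop : Continuous fun σ : ℝ => (t, σ)),
      intervalIntegral.continuous_parametric_intervalIntegral_of_continuous' (f := f) hf _ _⟩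
  have cr : Continuous fun p : ℝ × ℝ => L p.1 * R p.1 p.2 := by fun_prop
  have cμ : Continuous fun p : ℝ × ℝ => ∫ σ in (0:ℝ)..p.2, L p.1 * R p.1 σ :=
    intervalIntegral.continuous_parametric_intervalIntegral_of_continuous
      (f := fun (p : ℝ × ℝ) σ => L p.1 * R p.1 σ)
      (cr.comp (by fun_prop : Continuous fun q : (ℝ × ℝ) × ℝ => (q.1.1, q.2))) continuous_snd
  have sr := (param (fun t s => L t * R t s) cr).1
  have hφ : ∀ t ∈ Icc 0 T, ∀ s ∈ Icc (0:ℝ) 1, |M - ∫ σ in (0:ℝ)..s, L t * R t σ| ≤ M := by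
    intro t ht s hs
    have h0 : 0 ≤ ∫ σ in (0:ℝ)..s, L t * R t σ :=
      intervalIntegral.integral_nonneg hs.1 fun σ _ => (mul_pos (hL t) (hR t σ)).le
    have h1 : (∫ σ in (0:ℝ)..s, L t * R t σ) ≤ M := by
      rw [← hmass t ht]
      exact intervalIntegral.integral_mono_interval le_rfl hs.1 hs.2
        (Filter.Eventually.of_forall fun σ => (mul_pos (hL t) (hR t σ)).le)
        ((sr t).intervalIntegrable _ _)
    rw [abs_le]
    constructor <;> linarith
  set μ : ℝ → ℝ → ℝ := fun t s => ∫ σ in (0:ℝ)..s, L t * R t σ with hμ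
  have hM : 0 ≤ M := (abs_nonneg _).trans (hφ 0 ⟨le_rfl, hT.le⟩ 0 ⟨le_rfl, zero_le_one⟩)
  have skin := (param (fun t s => L t * (R t s * v t s ^ 2)) (by fun_prop)).1
  have smom := (param (fun t s => L t * (X t s ^ 2 * R t s)) (by fun_prop)).1
  have sφ := (param (fun t s => (M - μ t s) * (L t * R t s) * v t s) (by fun_prop)).1
  have hmomentum : ∀ t ∈ Icc 0 T,
      |∫ s in (0:ℝ)..1, (M - μ t s) * (L t * R t s) * v t s| ≤ M * (M / 2 + C₀) := by
    intro t ht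
    refine (intervalIntegral.abs_integral_le_integral_abs zero_le_one).trans ?_
    have h := intervalIntegral.integral_mono_on zero_le_one
      ((sφ t).abs.intervalIntegrable (μ := volume) _ _)
      ((((sr t).const_mul (M / 2)).add ((skin t).const_mul (M / 2))).intervalIntegrable
        (μ := volume) _ _) fun s hs => by
        have hr := mul_pos (hL t) (hR t s)
        rw [abs_mul, abs_mul, abs_of_pos hr]
        calc _ ≤ M * (L t * R t s) * |v t s| := by
              gcongr
              exact hφ t ht s hs
          _ ≤ M * (L t * R t s) * ((1 + v t s ^ 2) / 2) := by
              gcongr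
              nlinarith [sq_nonneg (|v t s| - 1), sq_abs (v t s)]
          _ = M / 2 * (L t * R t s) + M / 2 * (L t * (R t s * v t s ^ 2)) := by ring
    simp only [Pi.add_apply] at h
    rw [intervalIntegral.integral_add (((sr t).const_mul _).intervalIntegrable _ _)
      (((skin t).const_mul _).intervalIntegrable _ _),
      intervalIntegral.integral_const_mul (M / 2), intervalIntegral.integral_const_mul (M / 2),
      hmass t ht] at h
    have := hkin t ht
    nlinarith
  rw [intervalIntegral.integral_sub ((sφ T).intervalIntegrable _ _)
    ((sφ 0).intervalIntegrable _ _)] at hid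
  have hb1 := (abs_le.1 (hmomentum T ⟨hT.le, le_rfl⟩)).1
  have hb0 := (abs_le.1 (hmomentum 0 ⟨le_rfl, hT.le⟩)).2
  obtain ⟨sH, tH⟩ := param (fun t s => (M - μ t s) * F t s
    - L t * R t s * (κ * R t s ^ γ - ε * R t s ^ α * q t s)) (by fun_prop)
  obtain ⟨sP, tP⟩ := param (fun t s => L t * R t s ^ (γ + 1)) (by fun_prop)
  obtain ⟨sE, tE⟩ := param (fun t s => L t * (R t s ^ α * q t s ^ 2)) (by fun_prop)
  obtain ⟨sD, tD⟩ := param (fun t s => L t * (R t s ^ (α + γ - 3) * Rx t s ^ 2)) (by fun_prop)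
  have hpoint : ∀ t ∈ Icc 0 T, ∀ s ∈ Icc (0:ℝ) 1,
      κ * (L t * R t s ^ (γ + 1)) + ((M - μ t s) * F t s
        - L t * R t s * (κ * R t s ^ γ - ε * R t s ^ α * q t s))
      ≤ M * K * (L t * R t s + L t * (R t s * v t s ^ 2) + L t * (X t s ^ 2 * R t s))
        + ε / 2 * (L t * (R t s ^ α * q t s ^ 2))
        + (1 / 2 * (1 + 2 * (M / d) ^ (α + γ)) + ε / 2 * ((α + γ) ^ 2 * M
          * ∫ s in (0:ℝ)..1, L t * (R t s ^ (α + γ - 3) * Rx t s ^ 2))) * (L t * R t s) := by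
    intro t ht s hs
    have hR0 := hR t s
    have hsup := rpow_le_of_mass_of_gradient hd (hdL t) (by linarith : 0 < α + γ) ((param R cR).1 t)
      ((param Rx cRx).1 t) (hR t) (hRx t ht) (hmass t ht) hs
    set D := ∫ s in (0:ℝ)..1, L t * (R t s ^ (α + γ - 3) * Rx t s ^ 2)
    have hφF : (M - μ t s) * F t s
        ≤ M * (K * (L t * R t s + L t * (R t s * v t s ^ 2) + L t * (X t s ^ 2 * R t s))) :=
      (le_abs_self _).trans <| (abs_mul _ _).trans_le <|
        mul_le_mul (hφ t ht s hs) (hF t ht s hs) (abs_nonneg _) hM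
    have hpow : R t s ^ (α + 1) ≤ 1 + R t s ^ (α + γ) := by
      rcases le_total (R t s) 1 with h | h
      · have := rpow_le_one hR0.le h (by linarith : 0 ≤ α + 1)
        have := rpow_pos_of_pos hR0 (α + γ)
        linarith
      · have := rpow_le_rpow_of_exponent_le h (by linarith : α + 1 ≤ α + γ)
        linarith
    have eγ : R t s ^ (γ + 1) = R t s ^ γ * R t s := rpow_add_one hR0.ne' _
    have eα : R t s ^ (α + 1) = R t s ^ α * R t s := rpow_add_one hR0.ne' _
    have hvisc : ε * (L t * R t s ^ α * (R t s * q t s))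
        ≤ ε / 2 * (L t * (R t s ^ α * q t s ^ 2)) + ε / 2 * R t s ^ (α + 1) * (L t * R t s) := by
      rw [eα]
      have h0 : 0 ≤ ε * (L t * R t s ^ α) :=
        mul_nonneg hε.1.le (mul_nonneg (hL t).le (rpow_nonneg hR0.le _))
      nlinarith [mul_nonneg h0 (sq_nonneg (R t s - q t s))]
    have hsup' : ε / 2 * R t s ^ (α + 1) ≤ 1 / 2 * (1 + 2 * (M / d) ^ (α + γ))
        + ε / 2 * ((α + γ) ^ 2 * M * D) := by
      have hc : 0 ≤ (M / d) ^ (α + γ) := rpow_nonneg (div_nonneg hM hd.le) _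
      nlinarith [hε.1, hε.2]
    have := mul_le_mul_of_nonneg_right hsup' (mul_pos (hL t) hR0).le
    rw [eγ]
    nlinarith
  have hslice : ∀ t ∈ Icc 0 T,
      κ * (∫ s in (0:ℝ)..1, L t * R t s ^ (γ + 1)) + (∫ s in (0:ℝ)..1, ((M - μ t s) * F t s
        - L t * R t s * (κ * R t s ^ γ - ε * R t s ^ α * q t s)))
      ≤ (M * K * (M + 3 * C₀) + M / 2 * (1 + 2 * (M / d) ^ (α + γ)))
        + ε / 2 * (∫ s in (0:ℝ)..1, L t * (R t s ^ α * q t s ^ 2))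
        + (α + γ) ^ 2 * M ^ 2 / 2
          * (ε * ∫ s in (0:ℝ)..1, L t * (R t s ^ (α + γ - 3) * Rx t s ^ 2)) := by
    intro t ht
    set D := ∫ s in (0:ℝ)..1, L t * (R t s ^ (α + γ - 3) * Rx t s ^ 2)
    have iP := ((sP t).const_mul κ).intervalIntegrable (μ := volume) 0 1
    have iH := (sH t).intervalIntegrable (μ := volume) 0 1
    have ir := (sr t).intervalIntegrable (μ := volume) 0 1
    have ik := (skin t).intervalIntegrable (μ := volume) 0 1
    have im := (smom t).intervalIntegrable (μ := volume) 0 1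
    have iE := (sE t).intervalIntegrable (μ := volume) 0 1
    have h := intervalIntegral.integral_mono_on zero_le_one (iP.add iH)
      (((((ir.add ik).add im).const_mul (M * K)).add (iE.const_mul (ε / 2))).add
        (ir.const_mul _)) (hpoint t ht)
    rw [intervalIntegral.integral_add iP iH, intervalIntegral.integral_add
      ((((ir.add ik).add im).const_mul (M * K)).add (iE.const_mul (ε / 2))) (ir.const_mul _),
      intervalIntegral.integral_add (((ir.add ik).add im).const_mul (M * K)) (iE.const_mul (ε / 2)),
      intervalIntegral.integral_const_mul κ, intervalIntegral.integral_const_mul (M * K),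
      intervalIntegral.integral_const_mul (ε / 2), intervalIntegral.integral_const_mul (_ + _),
      intervalIntegral.integral_add (ir.add ik) im, intervalIntegral.integral_add ir ik,
      hmass t ht] at h
    have := mul_le_mul_of_nonneg_left (add_le_add (hkin t ht) (hmom t ht)) (mul_nonneg hM hK)
    linarith
  have jP := (tP.const_mul κ).intervalIntegrable (μ := volume) 0 T
  have jH := tH.intervalIntegrable (μ := volume) 0 T
  have jE := (tE.const_mul (ε / 2)).intervalIntegrable (μ := volume) 0 T
  have jD := ((tD.const_mul ε).const_mul ((α + γ) ^ 2 * M ^ 2 / 2)).intervalIntegrable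
    (μ := volume) 0 T
  have jc := intervalIntegrable_const (μ := volume) (a := 0) (b := T)
    (c := M * K * (M + 3 * C₀) + M / 2 * (1 + 2 * (M / d) ^ (α + γ)))
  have h := intervalIntegral.integral_mono_on hT.le (jP.add jH) ((jc.add jE).add jD) hslice
  rw [intervalIntegral.integral_add jP jH, intervalIntegral.integral_add (jc.add jE) jD,
    intervalIntegral.integral_add jc jE, intervalIntegral.integral_const_mul κ,
    intervalIntegral.integral_const_mul (ε / 2), intervalIntegral.integral_const_mul (_ / _),
    intervalIntegral.integral_const_mul ε, intervalIntegral.integral_const, hid, sub_zero,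
    smul_eq_mul] at h
  have := mul_le_mul_of_nonneg_left hgrad (by positivity : 0 ≤ (α + γ) ^ 2 * M ^ 2 / 2)
  linarith

/-- A bound for the derivative of the potential `(-|·| + (·)² / 2) ∗ ρ` in terms of the mass and
the second moment of `ρ`. -/
theorem abs_deriv_interaction_le {a b M C₀ x w : ℝ} {ρ : ℝ → ℝ} (hab : a ≤ b)
    (hρ : ContinuousOn ρ (Icc a b)) (h0 : ∀ y ∈ Icc a b, 0 ≤ ρ y) (hM : ∫ y in a..b, ρ y = M)
    (hmom : ∫ y in a..b, y ^ 2 * ρ y ≤ C₀)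
    (hw : HasDerivAt (fun z => ∫ y in a..b, (-|z - y| + (z - y) ^ 2 / 2) * ρ y) w x) :
    |w| ≤ M * (|x| + 3 / 2) + (M + C₀) / 2 := by
  have iρ : IntervalIntegrable ρ volume a b := hρ.intervalIntegrable_of_Icc hab
  have im : IntervalIntegrable (fun y => y ^ 2 * ρ y) volume a b :=
    ContinuousOn.intervalIntegrable_of_Icc hab (by fun_prop)
  have iW : ∀ z, IntervalIntegrable (fun y => (-|z - y| + (z - y) ^ 2 / 2) * ρ y) volume a b :=
    fun z => ContinuousOn.intervalIntegrable_of_Icc hab (by fun_prop)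
  have hM0 : 0 ≤ M := hM ▸ intervalIntegral.integral_nonneg hab h0
  have hm0 : 0 ≤ ∫ y in a..b, y ^ 2 * ρ y :=
    intervalIntegral.integral_nonneg hab fun y hy => mul_nonneg (sq_nonneg y) (h0 y hy)
  refine hw.le_of_lip' (by positivity [hm0.trans hmom]) ?_
  filter_upwards [Metric.ball_mem_nhds x one_pos] with z hz
  rw [Metric.mem_ball, dist_eq] at hz
  rw [norm_eq_abs, norm_eq_abs, ← intervalIntegral.integral_sub (iW z) (iW x)]
  have hz' : |z| ≤ |x| + 1 := by
    have := abs_sub_abs_le_abs_sub z x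
    linarith
  refine (intervalIntegral.abs_integral_le_integral_abs hab).trans ?_
  have h := intervalIntegral.integral_mono_on hab ((iW z).sub (iW x)).abs
    ((iρ.const_mul (|z - x| * (|x| + 2))).add (im.const_mul (|z - x| * (1 / 2)))) fun y hy => by
      have e : (-|z - y| + (z - y) ^ 2 / 2) * ρ y - (-|x - y| + (x - y) ^ 2 / 2) * ρ y
          = ((|x - y| - |z - y|) + (z - x) * ((z + x) / 2 - y)) * ρ y := by ring
      have h1 : |(|x - y| - |z - y|)| ≤ |z - x| := by
        have := abs_abs_sub_abs_le_abs_sub (x - y) (z - y)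
        rwa [sub_sub_sub_cancel_right, abs_sub_comm x z] at this
      have h2 : |(z + x) / 2 - y| ≤ |x| + 1 + y ^ 2 / 2 := by
        rw [abs_le]
        constructor <;>
          nlinarith [abs_le.1 hz', neg_abs_le x, le_abs_self x, sq_nonneg (y - 1),
            sq_nonneg (y + 1)]
      rw [e, abs_mul, abs_of_nonneg (h0 y hy)]
      calc _ ≤ (|z - x| + |z - x| * (|x| + 1 + y ^ 2 / 2)) * ρ y := by
            refine mul_le_mul_of_nonneg_right ((abs_add_le _ _).trans (add_le_add h1 ?_)) (h0 y hy)
            rw [abs_mul]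
            exact mul_le_mul_of_nonneg_left h2 (abs_nonneg _)
        _ = |z - x| * (|x| + 2) * ρ y + |z - x| * (1 / 2) * (y ^ 2 * ρ y) := by ring
  rw [intervalIntegral.integral_add (iρ.const_mul _) (im.const_mul _),
    intervalIntegral.integral_const_mul, intervalIntegral.integral_const_mul, hM] at h
  have := mul_le_mul_of_nonneg_left hmom (by positivity : 0 ≤ |z - x| * (1 / 2))
  linarith

/-- A bound for the alignment force with bounded communication weight in terms of the mass and the
kinetic energy. -/
theorem abs_alignment_le {a b M C₀ x : ℝ} {ρ u cw : ℝ → ℝ} (hab : a ≤ b)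
    (hρ : ContinuousOn ρ (Icc a b)) (hu : ContinuousOn u (Icc a b)) (h0 : ∀ y ∈ Icc a b, 0 ≤ ρ y)
    (hM : ∫ y in a..b, ρ y = M) (hkin : ∫ y in a..b, ρ y * u y ^ 2 ≤ 2 * C₀)
    (hcw : ∀ y, |cw y| ≤ C₀) :
    |∫ y in a..b, cw (x - y) * (u y - u x) * ρ y| ≤ C₀ * (M / 2 + C₀ + M * |u x|) := by
  have iρ : IntervalIntegrable ρ volume a b := hρ.intervalIntegrable_of_Icc hab
  have ik : IntervalIntegrable (fun y => ρ y * u y ^ 2) volume a b :=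
    ContinuousOn.intervalIntegrable_of_Icc hab (by fun_prop)
  have hC : 0 ≤ C₀ := (abs_nonneg _).trans (hcw 0)
  have h := intervalIntegral.norm_integral_le_of_norm_le (μ := volume) hab
    (f := fun y => cw (x - y) * (u y - u x) * ρ y)
    (g := fun y => C₀ * (1 / 2 + |u x|) * ρ y + C₀ / 2 * (ρ y * u y ^ 2))
    (Filter.Eventually.of_forall fun y hy => by
      have hy0 := h0 y (Ioc_subset_Icc_self hy)
      have h1 : |u y - u x| ≤ 1 / 2 + u y ^ 2 / 2 + |u x| := by
        refine (abs_sub _ _).trans ?_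
        nlinarith [sq_nonneg (|u y| - 1), sq_abs (u y)]
      rw [norm_eq_abs, abs_mul, abs_mul, abs_of_nonneg hy0]
      calc _ ≤ C₀ * (1 / 2 + u y ^ 2 / 2 + |u x|) * ρ y := by
            gcongr
            exact hcw _
        _ = _ := by ring)
    ((iρ.const_mul _).add (ik.const_mul _))
  rw [intervalIntegral.integral_add (iρ.const_mul _) (ik.const_mul _),
    intervalIntegral.integral_const_mul, intervalIntegral.integral_const_mul, hM,
    norm_eq_abs] at h
  have := mul_le_mul_of_nonneg_left hkin (by positivity : 0 ≤ C₀ / 2)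
  linarith

/-- The time-space domain between two curves. -/
def movingDomain (T : ℝ) (bm bp : ℝ → ℝ) : Set (ℝ × ℝ) :=
  {q : ℝ × ℝ | q.1 ∈ Icc (0:ℝ) T ∧ q.2 ∈ Icc (bm q.1) (bp q.1)}

/-- The truncation of `x` to `[a, b]`. -/
def clampIcc (a b x : ℝ) : ℝ := max a (min b x)

/-- The function `f` on the moving domain, in coordinates where the domain is `[0, T] × [0, 1]`,
and extended outside by clamping the coordinates. -/
def straighten (T : ℝ) (bm bp : ℝ → ℝ) (f : ℝ → ℝ → ℝ) (t s : ℝ) : ℝ :=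
  f (clampIcc 0 T t) (bm (clampIcc 0 T t)
    + (bp (clampIcc 0 T t) - bm (clampIcc 0 T t)) * clampIcc 0 1 s)

theorem continuous_clampIcc (a b : ℝ) : Continuous (clampIcc a b) := by
  unfold clampIcc; fun_prop

theorem clampIcc_mem {a b : ℝ} (h : a ≤ b) (x : ℝ) : clampIcc a b x ∈ Icc a b :=
  ⟨le_max_left _ _, max_le h (min_le_left _ _)⟩

theorem clampIcc_of_mem {a b x : ℝ} (hx : x ∈ Icc a b) : clampIcc a b x = x := by
  rw [clampIcc, min_eq_right hx.2, max_eq_right hx.1]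

section Straighten

variable {T : ℝ} {bm bp : ℝ → ℝ} {f ft fx : ℝ → ℝ → ℝ}

theorem straighten_of_mem {t s : ℝ} (ht : t ∈ Icc 0 T) (hs : s ∈ Icc (0:ℝ) 1) :
    straighten T bm bp f t s = f t (bm t + (bp t - bm t) * s) := by
  simp only [straighten, clampIcc_of_mem ht, clampIcc_of_mem hs]

theorem affine_mem_Icc {a b s : ℝ} (hab : a ≤ b) (hs : s ∈ Icc (0:ℝ) 1) :
    a + (b - a) * s ∈ Icc a b :=
  ⟨by nlinarith [hs.1, hs.2], by nlinarith [hs.1, hs.2]⟩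

theorem continuous_straighten (hT : 0 ≤ T) (hbm : ContinuousOn bm (Icc 0 T))
    (hbp : ContinuousOn bp (Icc 0 T)) (hb : ∀ t ∈ Icc 0 T, bm t ≤ bp t)
    (hf : ContinuousOn (fun q : ℝ × ℝ => f q.1 q.2) (movingDomain T bm bp)) :
    Continuous fun p : ℝ × ℝ => straighten T bm bp f p.1 p.2 := by
  have cT := continuous_clampIcc 0 T
  have c1 := continuous_clampIcc 0 1
  have cm : Continuous fun t => bm (clampIcc 0 T t) := hbm.comp_continuous cT (clampIcc_mem hT)
  have cp : Continuous fun t => bp (clampIcc 0 T t) := hbp.comp_continuous cT (clampIcc_mem hT)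
  have cm' := cm.comp (continuous_fst (Y := ℝ))
  have cp' := cp.comp (continuous_fst (Y := ℝ))
  refine hf.comp_continuous (f := fun p : ℝ × ℝ => (clampIcc 0 T p.1, bm (clampIcc 0 T p.1)
    + (bp (clampIcc 0 T p.1) - bm (clampIcc 0 T p.1)) * clampIcc 0 1 p.2))
    ((cT.comp continuous_fst).prodMk (cm'.add ((cp'.sub cm').mul (c1.comp continuous_snd)))) ?_
  exact fun p => ⟨clampIcc_mem hT _,
    affine_mem_Icc (hb _ (clampIcc_mem hT _)) (clampIcc_mem zero_le_one _)⟩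

theorem integral_eq_integral_straighten {t : ℝ} (ht : t ∈ Icc 0 T) :
    ∫ x in bm t..bp t, f t x = ∫ s in (0:ℝ)..1, (bp t - bm t) * straighten T bm bp f t s := by
  have h := intervalIntegral.smul_integral_comp_add_mul (a := 0) (b := 1) (f t) (bp t - bm t) (bm t)
  rw [mul_zero, add_zero, mul_one, add_sub_cancel, smul_eq_mul,
    ← intervalIntegral.integral_const_mul] at h
  rw [← h]
  refine intervalIntegral.integral_congr fun s hs => ?_
  rw [uIcc_of_le zero_le_one] at hs
  simp only [straighten_of_mem ht hs]

theorem continuousOn_integral_movingDomain (hT : 0 ≤ T) (hbm : ContinuousOn bm (Icc 0 T))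
    (hbp : ContinuousOn bp (Icc 0 T)) (hb : ∀ t ∈ Icc 0 T, bm t ≤ bp t)
    (hf : ContinuousOn (fun q : ℝ × ℝ => f q.1 q.2) (movingDomain T bm bp)) :
    ContinuousOn (fun t => ∫ x in bm t..bp t, f t x) (Icc 0 T) := by
  have c : Continuous fun t => ∫ s in (0:ℝ)..1, straighten T bm bp f t s :=
    intervalIntegral.continuous_parametric_intervalIntegral_of_continuous'
      (f := straighten T bm bp f) (continuous_straighten hT hbm hbp hb hf) _ _
  refine ((hbp.sub hbm).mul c.continuousOn).congr fun t ht => ?_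
  rw [integral_eq_integral_straighten ht, intervalIntegral.integral_const_mul]
  rfl

theorem hasDerivAt_straighten_space (hb : ∀ t ∈ Icc 0 T, bm t ≤ bp t)
    (hfx : ∀ t ∈ Icc 0 T, ∀ x ∈ Icc (bm t) (bp t), HasDerivAt (fun y => f t y) (fx t x) x)
    {t s : ℝ} (ht : t ∈ Icc 0 T) (hs : s ∈ Ioo (0:ℝ) 1) :
    HasDerivAt (fun σ => straighten T bm bp f t σ)
      ((bp t - bm t) * straighten T bm bp fx t s) s := by
  have hs' := Ioo_subset_Icc_self hs
  have h1 : HasDerivAt (fun σ => bm t + (bp t - bm t) * σ) (bp t - bm t) s := by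
    simpa using ((hasDerivAt_id s).const_mul (bp t - bm t)).const_add (bm t)
  have h2 := (hfx t ht _ (affine_mem_Icc (hb t ht) hs')).comp s h1
  rw [straighten_of_mem ht hs', mul_comm]
  refine h2.congr_of_eventuallyEq ?_
  filter_upwards [Ioo_mem_nhds hs.1 hs.2] with σ hσ
  exact straighten_of_mem ht (Ioo_subset_Icc_self hσ)

theorem hasDerivAt_straighten_time (hb : ∀ t ∈ Icc 0 T, bm t < bp t)
    (hft : ∀ t ∈ Icc 0 T, ∀ x ∈ Icc (bm t) (bp t), HasDerivAt (fun τ => f τ x) (ft t x) t)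
    (hfx : ∀ t ∈ Icc 0 T, ∀ x ∈ Icc (bm t) (bp t), HasDerivAt (fun y => f t y) (fx t x) x)
    (cft : ContinuousOn (fun q : ℝ × ℝ => ft q.1 q.2) (movingDomain T bm bp))
    (cfx : ContinuousOn (fun q : ℝ × ℝ => fx q.1 q.2) (movingDomain T bm bp))
    {bm' bp' t s : ℝ} (ht : t ∈ Ioo 0 T) (hs : s ∈ Ioo (0:ℝ) 1)
    (hbm : HasDerivAt bm bm' t) (hbp : HasDerivAt bp bp' t) :
    HasDerivAt (fun τ => straighten T bm bp f τ s)
      (straighten T bm bp ft t s + straighten T bm bp fx t s * (bm' + (bp' - bm') * s)) t := by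
  have ht' := Ioo_subset_Icc_self ht
  have hs' := Ioo_subset_Icc_self hs
  have hlt := hb t ht'
  set X : ℝ → ℝ := fun τ => bm τ + (bp τ - bm τ) * s with hX
  have hXd : HasDerivAt X (bm' + (bp' - bm') * s) t := hbm.add ((hbp.sub hbm).mul_const s)
  have hnhds : movingDomain T bm bp ∈ nhds (t, X t) := by
    have h1 : ∀ᶠ q : ℝ × ℝ in nhds (t, X t), q.1 ∈ Ioo 0 T :=
      continuousAt_fst.eventually (Ioo_mem_nhds ht.1 ht.2)
    have h2 : ∀ᶠ q : ℝ × ℝ in nhds (t, X t), bm q.1 < q.2 :=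
      Filter.Tendsto.eventually_lt (hbm.continuousAt.comp (x := (t, X t)) continuousAt_fst)
        continuousAt_snd (by simp only [Function.comp, hX]; nlinarith [hs.1])
    have h3 : ∀ᶠ q : ℝ × ℝ in nhds (t, X t), q.2 < bp q.1 :=
      Filter.Tendsto.eventually_lt continuousAt_snd
        (hbp.continuousAt.comp (x := (t, X t)) continuousAt_fst)
        (by simp only [Function.comp, hX]; nlinarith [hs.2])
    filter_upwards [h1, h2, h3] with q a b c using ⟨Ioo_subset_Icc_self a, b.le, c.le⟩
  have hF : HasFDerivAt (fun q : ℝ × ℝ => f q.1 q.2)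
      ((ContinuousLinearMap.toSpanSingleton ℝ (ft t (X t))).coprod
        (ContinuousLinearMap.toSpanSingleton ℝ (fx t (X t)))) (t, X t) :=
    (hasStrictFDerivAt_uncurry_coprod (𝕜 := ℝ) (u := (t, X t)) (f := f)
    (f₁ := fun a b => ContinuousLinearMap.toSpanSingleton ℝ (ft a b))
    (f₂ := fun a b => ContinuousLinearMap.toSpanSingleton ℝ (fx a b))
    (Filter.mem_of_superset hnhds fun q hq => (hft q.1 hq.1 q.2 hq.2).hasFDerivAt)
    (Filter.mem_of_superset hnhds fun q hq => (hfx q.1 hq.1 q.2 hq.2).hasFDerivAt)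
    (ContinuousLinearMap.toSpanSingletonCLE.continuous.continuousAt.comp
      (cft.continuousAt hnhds))
    (ContinuousLinearMap.toSpanSingletonCLE.continuous.continuousAt.comp
      (cfx.continuousAt hnhds))).hasFDerivAt
  have h := HasFDerivAt.comp_hasDerivAt t (f := fun τ => (τ, X τ)) hF ((hasDerivAt_id t).prodMk hXd)
  have hval : straighten T bm bp ft t s + straighten T bm bp fx t s * (bm' + (bp' - bm') * s)
      = ft t (X t) + (bm' + (bp' - bm') * s) * fx t (X t) := by
    rw [straighten_of_mem ht' hs', straighten_of_mem ht' hs']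
    ring
  rw [hval]
  refine HasDerivAt.congr_of_eventuallyEq (h.congr_deriv (by simp)) ?_
  filter_upwards [Ioo_mem_nhds ht.1 ht.2] with τ hτ
  exact straighten_of_mem (Ioo_subset_Icc_self hτ) hs'

end Straighten

/-- The momentum balance on a moving domain transported by the flow, tested against the mass to
the right of a point, in straightened coordinates. -/
theorem integral_straighten_momentum {T : ℝ} (hT : 0 < T) (M : ℝ) {bm bp : ℝ → ℝ}
    {ρ u ρt ρx ut ux P Px : ℝ → ℝ → ℝ} (hb : ∀ t ∈ Icc 0 T, bm t < bp t)
    (hρt : ∀ t ∈ Icc 0 T, ∀ x ∈ Icc (bm t) (bp t), HasDerivAt (fun τ => ρ τ x) (ρt t x) t)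
    (hρx : ∀ t ∈ Icc 0 T, ∀ x ∈ Icc (bm t) (bp t), HasDerivAt (fun y => ρ t y) (ρx t x) x)
    (hut : ∀ t ∈ Icc 0 T, ∀ x ∈ Icc (bm t) (bp t), HasDerivAt (fun τ => u τ x) (ut t x) t)
    (hux : ∀ t ∈ Icc 0 T, ∀ x ∈ Icc (bm t) (bp t), HasDerivAt (fun y => u t y) (ux t x) x)
    (hPx : ∀ t ∈ Icc 0 T, ∀ x ∈ Icc (bm t) (bp t), HasDerivAt (fun y => P t y) (Px t x) x)
    (cρ : ContinuousOn (fun q : ℝ × ℝ => ρ q.1 q.2) (movingDomain T bm bp))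
    (cu : ContinuousOn (fun q : ℝ × ℝ => u q.1 q.2) (movingDomain T bm bp))
    (cρt : ContinuousOn (fun q : ℝ × ℝ => ρt q.1 q.2) (movingDomain T bm bp))
    (cρx : ContinuousOn (fun q : ℝ × ℝ => ρx q.1 q.2) (movingDomain T bm bp))
    (cut : ContinuousOn (fun q : ℝ × ℝ => ut q.1 q.2) (movingDomain T bm bp))
    (cux : ContinuousOn (fun q : ℝ × ℝ => ux q.1 q.2) (movingDomain T bm bp))
    (cP : ContinuousOn (fun q : ℝ × ℝ => P q.1 q.2) (movingDomain T bm bp))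
    (cPx : ContinuousOn (fun q : ℝ × ℝ => Px q.1 q.2) (movingDomain T bm bp))
    (hcont : ∀ t ∈ Icc 0 T, ∀ x ∈ Icc (bm t) (bp t),
      ρt t x + (ρx t x * u t x + ρ t x * ux t x) = 0)
    (hbm : ∀ t ∈ Icc 0 T, HasDerivAt bm (u t (bm t)) t)
    (hbp : ∀ t ∈ Icc 0 T, HasDerivAt bp (u t (bp t)) t)
    (hPm : ∀ t ∈ Icc 0 T, P t (bm t) = 0) (hPp : ∀ t ∈ Icc 0 T, P t (bp t) = 0)
    {L : ℝ → ℝ} (hL : ∀ t, L t = bp (clampIcc 0 T t) - bm (clampIcc 0 T t))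
    {R v F : ℝ → ℝ → ℝ} (hR : R = straighten T bm bp ρ) (hv : v = straighten T bm bp u)
    (hF : ∀ t ∈ Icc 0 T, ∀ s ∈ Icc (0:ℝ) 1, F t s = L t * straighten T bm bp (fun t x =>
      ρt t x * u t x + ρ t x * ut t x + (ρx t x * u t x ^ 2 + 2 * ρ t x * u t x * ux t x)
        + Px t x) t s) :
    (∫ t in 0..T, ∫ s in (0:ℝ)..1, ((M - ∫ σ in (0:ℝ)..s, L t * R t σ) * F t s
        - L t * R t s * straighten T bm bp P t s))
      = ∫ s in (0:ℝ)..1, ((M - ∫ σ in (0:ℝ)..s, L T * R T σ) * (L T * R T s) * v T s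
        - (M - ∫ σ in (0:ℝ)..s, L 0 * R 0 σ) * (L 0 * R 0 s) * v 0 s) := by
  have hb' : ∀ t ∈ Icc 0 T, bm t ≤ bp t := fun t ht => (hb t ht).le
  have cbm : ContinuousOn bm (Icc 0 T) := fun t ht => (hbm t ht).continuousAt.continuousWithinAt
  have cbp : ContinuousOn bp (Icc 0 T) := fun t ht => (hbp t ht).continuousAt.continuousWithinAt
  have cst {f : ℝ → ℝ → ℝ}
      (hf : ContinuousOn (fun q : ℝ × ℝ => f q.1 q.2) (movingDomain T bm bp)) :=
    continuous_straighten hT.le cbm cbp hb' hf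
  have cL : Continuous L := by
    rw [funext hL]
    exact (cbp.comp_continuous (continuous_clampIcc 0 T) (clampIcc_mem hT.le)).sub
      (cbm.comp_continuous (continuous_clampIcc 0 T) (clampIcc_mem hT.le))
  have cR : Continuous fun p : ℝ × ℝ => R p.1 p.2 := hR ▸ cst cρ
  have cv : Continuous fun p : ℝ × ℝ => v p.1 p.2 := hv ▸ cst cu
  have cv0 : Continuous fun p : ℝ × ℝ => v p.1 0 :=
    cv.comp (continuous_fst.prodMk continuous_const)
  have cv1 : Continuous fun p : ℝ × ℝ => v p.1 1 :=
    cv.comp (continuous_fst.prodMk continuous_const)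
  have cRx := cst cρx
  have cvt := cst cut
  have cvx := cst cux
  have hLt : ∀ t ∈ Icc 0 T, L t = bp t - bm t := fun t ht => by rw [hL, clampIcc_of_mem ht]
  have hv0 : ∀ t ∈ Icc 0 T, v t 0 = u t (bm t) := fun t ht => by
    rw [hv, straighten_of_mem ht (left_mem_Icc.2 zero_le_one)]; simp
  have hv1 : ∀ t ∈ Icc 0 T, v t 1 = u t (bp t) := fun t ht => by
    rw [hv, straighten_of_mem ht (right_mem_Icc.2 zero_le_one)]; simp
  have hpde : ∀ t ∈ Icc 0 T, ∀ s ∈ Icc (0:ℝ) 1, straighten T bm bp ρt t s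
      = -(straighten T bm bp ρx t s * v t s + R t s * straighten T bm bp ux t s) := by
    intro t ht s hs
    have := hcont t ht _ (affine_mem_Icc (hb' t ht) hs)
    rw [hv, hR]
    simp only [straighten_of_mem ht hs]
    linarith
  refine integral_mass_weighted_momentum hT M
    (r := fun t s => L t * R t s)
    (J := fun t s => R t s * (v t s - (v t 0 + (v t 1 - v t 0) * s)))
    (J' := fun t s => L t * straighten T bm bp ρx t s * (v t s - (v t 0 + (v t 1 - v t 0) * s))
      + R t s * (L t * straighten T bm bp ux t s - (v t 1 - v t 0)))
    (vt := fun t s => straighten T bm bp ut t s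
      + straighten T bm bp ux t s * (v t 0 + (v t 1 - v t 0) * s))
    (vs := fun t s => L t * straighten T bm bp ux t s)
    (S' := fun t s => L t * straighten T bm bp Px t s)
    (by fun_prop) (by fun_prop) (by fun_prop) cv (by fun_prop) (by fun_prop) (cst cP)
    ((cL.comp continuous_fst).mul (cst cPx)) ?_ ?_ ?_ ?_ ?_ ?_ ?_ ?_ ?_ ?_
  · intro t ht s hs
    have ht' := Ioo_subset_Icc_self ht
    have h1 : HasDerivAt L (v t 1 - v t 0) t := by
      rw [hv0 t ht', hv1 t ht']
      refine ((hbp t ht').sub (hbm t ht')).congr_of_eventuallyEq ?_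
      filter_upwards [Ioo_mem_nhds ht.1 ht.2] with τ hτ using hLt τ (Ioo_subset_Icc_self hτ)
    have h2 := hasDerivAt_straighten_time hb hρt hρx cρt cρx ht hs (hbm t ht') (hbp t ht')
    rw [← hv0 t ht', ← hv1 t ht', ← hR] at h2
    refine (h1.mul h2).congr_deriv ?_
    rw [hpde t ht' s (Ioo_subset_Icc_self hs)]
    ring
  · intro t ht s hs
    have ht' := Ioo_subset_Icc_self ht
    have h1 := hasDerivAt_straighten_space hb' hρx ht' hs
    have h2 := hasDerivAt_straighten_space hb' hux ht' hs
    rw [← hLt t ht', ← hR] at h1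
    rw [← hLt t ht', ← hv] at h2
    refine (h1.mul (h2.sub (((hasDerivAt_id s).const_mul (v t 1 - v t 0)).const_add
      (v t 0)))).congr_deriv ?_
    simp
  · intro t ht s hs
    have ht' := Ioo_subset_Icc_self ht
    have h2 := hasDerivAt_straighten_time hb hut hux cut cux ht hs (hbm t ht') (hbp t ht')
    rwa [← hv0 t ht', ← hv1 t ht', ← hv] at h2
  · intro t ht s hs
    have ht' := Ioo_subset_Icc_self ht
    have h2 := hasDerivAt_straighten_space hb' hux ht' hs
    rwa [← hLt t ht', ← hv] at h2
  · intro t ht s hs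
    have ht' := Ioo_subset_Icc_self ht
    have h2 := hasDerivAt_straighten_space hb' hPx ht' hs
    rwa [← hLt t ht'] at h2
  · intro t ht s hs
    have ht' := Ioo_subset_Icc_self ht
    have hs' := Ioo_subset_Icc_self hs
    have h1 := hpde t ht' s hs'
    have h2 : straighten T bm bp (fun t x => ρt t x * u t x + ρ t x * ut t x
        + (ρx t x * u t x ^ 2 + 2 * ρ t x * u t x * ux t x) + Px t x) t s
        = straighten T bm bp ρt t s * v t s + R t s * straighten T bm bp ut t s
        + (straighten T bm bp ρx t s * v t s ^ 2
          + 2 * R t s * v t s * straighten T bm bp ux t s) + straighten T bm bp Px t s := by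
      rw [hR, hv]; rfl
    rw [hF t ht' s hs', h2, h1]
    ring
  · intro t; simp
  · intro t; simp
  · intro t
    have := hPm _ (clampIcc_mem hT.le t)
    simpa [straighten, clampIcc_of_mem (left_mem_Icc.2 zero_le_one)] using this
  · intro t
    have := hPp _ (clampIcc_mem hT.le t)
    simpa [straighten, clampIcc_of_mem (right_mem_Icc.2 zero_le_one)] using this

/-- A pointwise bound for the sum of the damping, interaction and alignment forces. -/
theorem abs_force_le {a b M C₀ lam x w : ℝ} {ρ u cw : ℝ → ℝ} (hab : a ≤ b)
    (hρ : ContinuousOn ρ (Icc a b)) (hu : ContinuousOn u (Icc a b)) (h0 : ∀ y ∈ Icc a b, 0 ≤ ρ y)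
    (hM : ∫ y in a..b, ρ y = M) (hkin : ∫ y in a..b, ρ y * u y ^ 2 ≤ 2 * C₀)
    (hmom : ∫ y in a..b, y ^ 2 * ρ y ≤ C₀) (hcw : ∀ y, |cw y| ≤ C₀) (hlam : |lam| ≤ C₀)
    (hw : HasDerivAt (fun z => ∫ y in a..b, (-|z - y| + (z - y) ^ 2 / 2) * ρ y) w x)
    (hx : x ∈ Icc a b) :
    |lam * ρ x * u x - ρ x * w + ρ x * ∫ y in a..b, cw (x - y) * (u y - u x) * ρ y|
      ≤ (C₀ + (5 / 2 * M + (M + C₀) / 2) + C₀ * (3 / 2 * M + C₀))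
        * (ρ x + ρ x * u x ^ 2 + x ^ 2 * ρ x) := by
  have h1 := abs_deriv_interaction_le hab hρ h0 hM hmom hw
  have h2 := abs_alignment_le (x := x) hab hρ hu h0 hM hkin hcw
  set A := ∫ y in a..b, cw (x - y) * (u y - u x) * ρ y
  have hC : 0 ≤ C₀ := (abs_nonneg _).trans hlam
  have hM0 : 0 ≤ M := hM ▸ intervalIntegral.integral_nonneg hab h0
  have hρx := h0 x hx
  set Y := 1 + u x ^ 2 + x ^ 2 with hY
  have hu1 : |u x| ≤ Y := by
    rw [abs_le]; constructor <;> nlinarith [sq_nonneg (u x - 1), sq_nonneg (u x + 1), sq_nonneg x]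
  have hx1 : |x| ≤ Y := by
    rw [abs_le]; constructor <;> nlinarith [sq_nonneg (x - 1), sq_nonneg (x + 1), sq_nonneg (u x)]
  have hY1 : 1 ≤ Y := by nlinarith [sq_nonneg (u x), sq_nonneg x]
  have hlu : |lam * u x| ≤ C₀ * Y := by
    rw [abs_mul]; exact mul_le_mul hlam hu1 (abs_nonneg _) hC
  have hw1 : |w| ≤ (5 / 2 * M + (M + C₀) / 2) * Y := by
    nlinarith [mul_le_mul_of_nonneg_left hx1 hM0, mul_le_mul_of_nonneg_left hY1 hM0,
      mul_le_mul_of_nonneg_left hY1 hC]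
  have hA : |A| ≤ C₀ * (3 / 2 * M + C₀) * Y := by
    refine h2.trans ?_
    rw [mul_assoc]
    refine mul_le_mul_of_nonneg_left ?_ hC
    nlinarith [mul_le_mul_of_nonneg_left hu1 hM0, mul_le_mul_of_nonneg_left hY1 hM0,
      mul_le_mul_of_nonneg_left hY1 hC]
  have h3 : |lam * u x - w + A| ≤ (C₀ + (5 / 2 * M + (M + C₀) / 2) + C₀ * (3 / 2 * M + C₀)) * Y :=
    calc |lam * u x - w + A| ≤ |lam * u x| + |w| + |A| :=
          (abs_add_le _ _).trans (add_le_add_left (abs_sub _ _) _)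
      _ ≤ _ := by rw [add_mul, add_mul]; gcongr
  calc |lam * ρ x * u x - ρ x * w + ρ x * A| = ρ x * |lam * u x - w + A| := by
        rw [← abs_of_nonneg hρx, ← abs_mul, abs_of_nonneg hρx]; ring_nf
    _ ≤ ρ x * ((C₀ + (5 / 2 * M + (M + C₀) / 2) + C₀ * (3 / 2 * M + C₀)) * Y) :=
        mul_le_mul_of_nonneg_left h3 hρx
    _ = _ := by rw [hY]; ring

/-- Higher integrability of the density (Lemma 3.5) for the viscous free-boundary problem
with polytropic pressure P(ρ) = κρ^γ, viscosity μ(ρ) = ρ^α, interaction potential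
W(x) = -|x| + x²/2 and communication weight `cw`. The constant C depends only on
C₀, M, r₁, r₂, T, γ, α and κ, and in particular not on ε ∈ (0,1]. -/
theorem density_higher_integrability
    (γ κ α T C₀ M r₁ r₂ : ℝ)
    (hγ : 1 < γ) (hκ : 0 < κ) (hα : 0 ≤ α) (hαγ : α ≤ γ) (hT : 0 < T) (hr : r₁ < r₂) :
    ∃ C : ℝ, 0 < C ∧
      ∀ (ε lam : ℝ) (cw : ℝ → ℝ) (bm bp : ℝ → ℝ)
        (ρ u ρt ρx ut ux uxx Wx : ℝ → ℝ → ℝ),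
        ε ∈ Set.Ioc (0:ℝ) 1 →
        -- communication weight: bounded (by C₀), measurable, even, nonnegative
        Measurable cw → (∀ x, |cw x| ≤ C₀) → (∀ x, cw (-x) = cw x) → (∀ x, 0 ≤ cw x) →
        -- damping bounded
        |lam| ≤ C₀ →
        (∀ t ∈ Set.Icc (0:ℝ) T, bm t < bp t) →
        (∀ t ∈ Set.Icc (0:ℝ) T, ∀ x ∈ Set.Icc (bm t) (bp t), 0 < ρ t x) →
        -- classical regularity on the domain
        (∀ t ∈ Set.Icc (0:ℝ) T, ∀ x ∈ Set.Icc (bm t) (bp t),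
          HasDerivAt (fun s => ρ s x) (ρt t x) t) →
        (∀ t ∈ Set.Icc (0:ℝ) T, ∀ x ∈ Set.Icc (bm t) (bp t),
          HasDerivAt (fun y => ρ t y) (ρx t x) x) →
        (∀ t ∈ Set.Icc (0:ℝ) T, ∀ x ∈ Set.Icc (bm t) (bp t),
          HasDerivAt (fun s => u s x) (ut t x) t) →
        (∀ t ∈ Set.Icc (0:ℝ) T, ∀ x ∈ Set.Icc (bm t) (bp t),
          HasDerivAt (fun y => u t y) (ux t x) x) →
        (∀ t ∈ Set.Icc (0:ℝ) T, ∀ x ∈ Set.Icc (bm t) (bp t),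
          HasDerivAt (fun y => ux t y) (uxx t x) x) →
        ContinuousOn
          (fun q : ℝ × ℝ => (ρ q.1 q.2, u q.1 q.2, ρt q.1 q.2, ρx q.1 q.2,
            ut q.1 q.2, ux q.1 q.2, uxx q.1 q.2))
          {q : ℝ × ℝ | q.1 ∈ Set.Icc (0:ℝ) T ∧ q.2 ∈ Set.Icc (bm q.1) (bp q.1)} →
        -- Wx is the spatial derivative of W∗ρ
        (∀ t ∈ Set.Icc (0:ℝ) T, ∀ x ∈ Set.Icc (bm t) (bp t),
          HasDerivAt (fun z => ∫ y in bm t..bp t, (-|z - y| + (z - y)^2 / 2) * ρ t y)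
            (Wx t x) x) →
        -- continuity equation
        (∀ t ∈ Set.Icc (0:ℝ) T, ∀ x ∈ Set.Icc (bm t) (bp t),
          ρt t x + (ρx t x * u t x + ρ t x * ux t x) = 0) →
        -- momentum equation
        (∀ t ∈ Set.Icc (0:ℝ) T, ∀ x ∈ Set.Icc (bm t) (bp t),
          (ρt t x * u t x + ρ t x * ut t x)
            + (ρx t x * (u t x)^2 + 2 * ρ t x * u t x * ux t x
                + κ * γ * ρ t x ^ (γ - 1) * ρx t x)
          = ε * (α * ρ t x ^ (α - 1) * ρx t x * ux t x + ρ t x ^ α * uxx t x)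
            + lam * ρ t x * u t x - ρ t x * Wx t x
            + ρ t x * ∫ y in bm t..bp t, cw (x - y) * (u t y - u t x) * ρ t y) →
        -- free-boundary ODEs
        (∀ t ∈ Set.Icc (0:ℝ) T, HasDerivAt bp (u t (bp t)) t) →
        (∀ t ∈ Set.Icc (0:ℝ) T, HasDerivAt bm (u t (bm t)) t) →
        -- stress-free boundary conditions
        (∀ t ∈ Set.Icc (0:ℝ) T,
          κ * ρ t (bp t) ^ γ - ε * ρ t (bp t) ^ α * ux t (bp t) = 0) →
        (∀ t ∈ Set.Icc (0:ℝ) T,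
          κ * ρ t (bm t) ^ γ - ε * ρ t (bm t) ^ α * ux t (bm t) = 0) →
        -- uniform bounds
        (∀ t ∈ Set.Icc (0:ℝ) T, (∫ x in bm t..bp t, ρ t x) = M) →
        (∀ t ∈ Set.Icc (0:ℝ) T,
          (∫ x in bm t..bp t,
              (1/2 * ρ t x * (u t x)^2 + ρ t x * (κ * ρ t x ^ (γ - 1) / (γ - 1))))
            + ε * (∫ s in (0:ℝ)..T, ∫ x in bm s..bp s, ρ s x ^ α * (ux s x)^2) ≤ C₀) →
        (∀ t ∈ Set.Icc (0:ℝ) T, (∫ x in bm t..bp t, x^2 * ρ t x) ≤ C₀) →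
        ε * (∫ s in (0:ℝ)..T, ∫ x in bm s..bp s,
            ρ s x ^ (α + γ - 3) * (ρx s x)^2) ≤ C₀ →
        -- [r₁, r₂] is contained in the open domain for all times
        (∀ t ∈ Set.Icc (0:ℝ) T, bm t < r₁ ∧ r₂ < bp t) →
        -- conclusion
        (∫ t in (0:ℝ)..T, ∫ x in r₁..r₂, ρ t x ^ (γ + 1)) ≤ C := by
  set K := C₀ + (5 / 2 * M + (M + C₀) / 2) + C₀ * (3 / 2 * M + C₀)
  set B := M * (M + 2 * C₀) + T * (M * K * (M + 3 * C₀)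
    + M / 2 * (1 + 2 * (M / (r₂ - r₁)) ^ (α + γ))) + C₀ / 2 + (α + γ) ^ 2 * M ^ 2 / 2 * C₀
  refine ⟨max 1 (B / κ), lt_max_of_lt_left one_pos, ?_⟩
  intro ε lam cw bm bp ρ u ρt ρx ut ux uxx Wx hε _ hcw _ _ hlam hb hpos hρt hρx hut hux huxx hcts
    hWx hcont hmomentum hbp hbm hsp hsm hmass henergy hmoment hgrad hsub
  refine le_max_of_le_right ((le_div_iff₀' hκ).2 ?_)
  change ContinuousOn _ (movingDomain T bm bp) at hcts
  have cρ : ContinuousOn (fun q : ℝ × ℝ => ρ q.1 q.2) (movingDomain T bm bp) := hcts.fst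
  have cu : ContinuousOn (fun q : ℝ × ℝ => u q.1 q.2) (movingDomain T bm bp) := hcts.snd.fst
  have cρt : ContinuousOn (fun q : ℝ × ℝ => ρt q.1 q.2) (movingDomain T bm bp) :=
    hcts.snd.snd.fst
  have cρx : ContinuousOn (fun q : ℝ × ℝ => ρx q.1 q.2) (movingDomain T bm bp) :=
    hcts.snd.snd.snd.fst
  have cut : ContinuousOn (fun q : ℝ × ℝ => ut q.1 q.2) (movingDomain T bm bp) :=
    hcts.snd.snd.snd.snd.fst
  have cux : ContinuousOn (fun q : ℝ × ℝ => ux q.1 q.2) (movingDomain T bm bp) :=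
    hcts.snd.snd.snd.snd.snd.fst
  have cuxx : ContinuousOn (fun q : ℝ × ℝ => uxx q.1 q.2) (movingDomain T bm bp) :=
    hcts.snd.snd.snd.snd.snd.snd
  have crp : ∀ p : ℝ, ContinuousOn (fun q : ℝ × ℝ => ρ q.1 q.2 ^ p) (movingDomain T bm bp) :=
    fun p => cρ.rpow_const fun q hq => Or.inl (hpos q.1 hq.1 q.2 hq.2).ne'
  have hb' : ∀ t ∈ Icc 0 T, bm t ≤ bp t := fun t ht => (hb t ht).le
  have cbm : ContinuousOn bm (Icc 0 T) := fun t ht => (hbm t ht).continuousAt.continuousWithinAt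
  have cbp : ContinuousOn bp (Icc 0 T) := fun t ht => (hbp t ht).continuousAt.continuousWithinAt
  have cst {f : ℝ → ℝ → ℝ}
      (hf : ContinuousOn (fun q : ℝ × ℝ => f q.1 q.2) (movingDomain T bm bp)) :=
    continuous_straighten hT.le cbm cbp hb' hf
  have slice {f : ℝ → ℝ → ℝ}
      (hf : ContinuousOn (fun q : ℝ × ℝ => f q.1 q.2) (movingDomain T bm bp))
      {t : ℝ} (ht : t ∈ Icc 0 T) : ContinuousOn (f t) (Icc (bm t) (bp t)) :=
    hf.comp (f := fun x : ℝ => (t, x)) (by fun_prop) fun x hx => ⟨ht, hx⟩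
  have h0T : (0:ℝ) ∈ Icc 0 T := left_mem_Icc.2 hT.le
  have hC : 0 ≤ C₀ := (abs_nonneg _).trans hlam
  have hM : 0 ≤ M := hmass 0 h0T ▸
    intervalIntegral.integral_nonneg (hb' 0 h0T) fun x hx => (hpos 0 h0T x hx).le
  have hK : 0 ≤ K := by positivity
  have hint : ∀ t ∈ Icc 0 T, ∀ x ∈ Icc (bm t) (bp t),
      0 ≤ ρ t x * (κ * ρ t x ^ (γ - 1) / (γ - 1)) := fun t ht x hx => by
    have := hpos t ht x hx
    have := sub_pos.2 hγ
    positivity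
  have hdiss0 : 0 ≤ ε * ∫ s in (0:ℝ)..T, ∫ x in bm s..bp s, ρ s x ^ α * (ux s x)^2 :=
    mul_nonneg hε.1.le <| intervalIntegral.integral_nonneg hT.le fun s hs =>
      intervalIntegral.integral_nonneg (hb' s hs) fun x hx => by
        have := hpos s hs x hx
        positivity
  have hkin : ∀ t ∈ Icc 0 T, ∫ x in bm t..bp t, ρ t x * u t x ^ 2 ≤ 2 * C₀ := by
    intro t ht
    have c1 := slice (f := fun t x => 1 / 2 * (ρ t x * u t x ^ 2)) (by fun_prop) ht
    have c2 := slice (f := fun t x => 1 / 2 * ρ t x * (u t x)^2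
      + ρ t x * (κ * ρ t x ^ (γ - 1) / (γ - 1))) (by have := crp (γ - 1); fun_prop) ht
    have h := intervalIntegral.integral_mono_on (μ := volume) (hb' t ht)
      (c1.intervalIntegrable_of_Icc (hb' t ht)) (c2.intervalIntegrable_of_Icc (hb' t ht))
      fun x hx => by linarith [hint t ht x hx]
    rw [intervalIntegral.integral_const_mul] at h
    linarith [henergy t ht]
  have hdiss : ε * (∫ s in (0:ℝ)..T, ∫ x in bm s..bp s, ρ s x ^ α * (ux s x)^2) ≤ C₀ := by
    refine le_trans (le_add_of_nonneg_left ?_) (henergy 0 h0T)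
    refine intervalIntegral.integral_nonneg (hb' 0 h0T) fun x hx => ?_
    have := hpos 0 h0T x hx
    have := hint 0 h0T x hx
    positivity
  have cL : Continuous fun t => bp (clampIcc 0 T t) - bm (clampIcc 0 T t) :=
    (cbp.comp_continuous (continuous_clampIcc 0 T) (clampIcc_mem hT.le)).sub
      (cbm.comp_continuous (continuous_clampIcc 0 T) (clampIcc_mem hT.le))
  set L : ℝ → ℝ := fun t => bp (clampIcc 0 T t) - bm (clampIcc 0 T t) with hL
  have hLt : ∀ t ∈ Icc 0 T, bp t - bm t = L t := fun t ht => by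
    simp only [hL, clampIcc_of_mem ht]
  have transfer (f : ℝ → ℝ → ℝ) {t : ℝ} (ht : t ∈ Icc 0 T) :
      ∫ x in bm t..bp t, f t x = ∫ s in (0:ℝ)..1, L t * straighten T bm bp f t s := by
    rw [integral_eq_integral_straighten ht, hLt t ht]
  have transfer' (f : ℝ → ℝ → ℝ) : (∫ t in (0:ℝ)..T, ∫ x in bm t..bp t, f t x)
      = ∫ t in (0:ℝ)..T, ∫ s in (0:ℝ)..1, L t * straighten T bm bp f t s :=
    intervalIntegral.integral_congr fun t ht => transfer f (uIcc_of_le hT.le ▸ ht)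
  have hP : ∀ t ∈ Icc 0 T, ∀ x ∈ Icc (bm t) (bp t),
      HasDerivAt (fun y => κ * ρ t y ^ γ - ε * ρ t y ^ α * ux t y)
        (κ * γ * ρ t x ^ (γ - 1) * ρx t x
          - ε * (α * ρ t x ^ (α - 1) * ρx t x * ux t x + ρ t x ^ α * uxx t x)) x := by
    intro t ht x hx
    have hne := (hpos t ht x hx).ne'
    have h1 := (hρx t ht x hx).rpow_const (p := γ) (Or.inl hne)
    have h2 := (hρx t ht x hx).rpow_const (p := α) (Or.inl hne)
    refine ((h1.const_mul κ).sub ((h2.const_mul ε).mul (huxx t ht x hx))).congr_deriv ?_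
    ring
  have cP : ContinuousOn (fun q : ℝ × ℝ =>
      κ * ρ q.1 q.2 ^ γ - ε * ρ q.1 q.2 ^ α * ux q.1 q.2) (movingDomain T bm bp) := by
    have := crp γ
    have := crp α
    fun_prop
  have cPx : ContinuousOn (fun q : ℝ × ℝ => κ * γ * ρ q.1 q.2 ^ (γ - 1) * ρx q.1 q.2
      - ε * (α * ρ q.1 q.2 ^ (α - 1) * ρx q.1 q.2 * ux q.1 q.2
        + ρ q.1 q.2 ^ α * uxx q.1 q.2)) (movingDomain T bm bp) := by
    have := crp (γ - 1)
    have := crp α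
    have := crp (α - 1)
    fun_prop
  set G : ℝ → ℝ → ℝ := fun t x => ρt t x * u t x + ρ t x * ut t x
    + (ρx t x * u t x ^ 2 + 2 * ρ t x * u t x * ux t x)
    + (κ * γ * ρ t x ^ (γ - 1) * ρx t x
      - ε * (α * ρ t x ^ (α - 1) * ρx t x * ux t x + ρ t x ^ α * uxx t x)) with hG
  have cG : ContinuousOn (fun q : ℝ × ℝ => G q.1 q.2) (movingDomain T bm bp) := by
    simp only [hG]
    fun_prop
  have hGK : ∀ t ∈ Icc 0 T, ∀ x ∈ Icc (bm t) (bp t),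
      |G t x| ≤ K * (ρ t x + ρ t x * u t x ^ 2 + x ^ 2 * ρ t x) := by
    intro t ht x hx
    have h := abs_force_le (lam := lam) (hb' t ht) (slice cρ ht) (slice cu ht)
      (fun y hy => (hpos t ht y hy).le) (hmass t ht) (hkin t ht) (hmoment t ht) hcw hlam
      (hWx t ht x hx) hx
    convert h using 2
    simp only [hG]
    linarith [hmomentum t ht x hx]
  have hid := integral_straighten_momentum hT M hb hρt hρx hut hux hP cρ cu cρt cρx cut cux cP cPx
    hcont hbm hbp hsm hsp (L := L) (fun _ => rfl) rfl rfl
    (F := fun t s => L t * straighten T bm bp G t s) fun _ _ _ _ => rfl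
  have cX : ContinuousOn (fun q : ℝ × ℝ => (fun _ x => x : ℝ → ℝ → ℝ) q.1 q.2)
    (movingDomain T bm bp) := continuousOn_snd
  have key := integral_rpow_le_of_mass_weighted_identity (κ := κ) (d := r₂ - r₁) (C₀ := C₀)
    hγ hα hT (sub_pos.2 hr) hK hε
    (L := L) (R := straighten T bm bp ρ) (Rx := straighten T bm bp ρx) (v := straighten T bm bp u)
    (q := straighten T bm bp ux) (X := straighten T bm bp fun _ x => x)
    (F := fun t s => L t * straighten T bm bp G t s)
    cL (cst cρ) (cst cρx) (cst cu) (cst cux) (cst cX) ((cL.comp continuous_fst).mul (cst cG))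
    (fun t => by
      have h := hsub _ (clampIcc_mem hT.le t)
      simp only [hL]
      linarith)
    (fun t s => hpos _ (clampIcc_mem hT.le t) _
      (affine_mem_Icc (hb' _ (clampIcc_mem hT.le t)) (clampIcc_mem zero_le_one s)))
    (fun t ht s hs => hLt t ht ▸ hasDerivAt_straighten_space hb' hρx ht hs)
    (fun t ht s hs => by
      have hL0 : 0 ≤ L t := hLt t ht ▸ sub_nonneg.2 (hb' t ht)
      have h := mul_le_mul_of_nonneg_left (hGK t ht _ (affine_mem_Icc (hb' t ht) hs)) hL0
      rw [abs_mul, abs_of_nonneg hL0]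
      simp only [straighten_of_mem ht hs]
      linarith)
    (fun t ht => (transfer ρ ht).symm.trans (hmass t ht))
    (fun t ht => (transfer (fun t x => ρ t x * u t x ^ 2) ht).symm.trans_le (hkin t ht))
    (fun t ht => (transfer (fun t x => x ^ 2 * ρ t x) ht).symm.trans_le (hmoment t ht))
    (by rw [transfer' fun s x => ρ s x ^ α * (ux s x) ^ 2] at hdiss; exact hdiss)
    (by rw [transfer' fun s x => ρ s x ^ (α + γ - 3) * (ρx s x) ^ 2] at hgrad; exact hgrad)
    hid
  refine le_trans (mul_le_mul_of_nonneg_left ?_ hκ.le) key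
  refine le_trans ?_ (transfer' fun t x => ρ t x ^ (γ + 1)).le
  have hsub' : movingDomain T (fun _ => r₁) (fun _ => r₂) ⊆ movingDomain T bm bp :=
    fun q hq => ⟨hq.1, (hsub _ hq.1).1.le.trans hq.2.1, hq.2.2.trans (hsub _ hq.1).2.le⟩
  have cI := continuousOn_integral_movingDomain (f := fun t x => ρ t x ^ (γ + 1)) hT.le
    continuousOn_const continuousOn_const (fun _ _ => hr.le) ((crp (γ + 1)).mono hsub')
  have cJ := continuousOn_integral_movingDomain (f := fun t x => ρ t x ^ (γ + 1)) hT.le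
    cbm cbp hb' (crp (γ + 1))
  refine intervalIntegral.integral_mono_on hT.le (cI.intervalIntegrable_of_Icc hT.le)
    (cJ.intervalIntegrable_of_Icc hT.le) fun t ht => ?_
  refine intervalIntegral.integral_mono_interval (hsub t ht).1.le hr.le (hsub t ht).2.le ?_
    ((slice (f := fun t x => ρ t x ^ (γ + 1)) (crp (γ + 1)) ht).intervalIntegrable_of_Icc
      (hb' t ht))
  filter_upwards [ae_restrict_mem measurableSet_Ioc] with x hx
  exact (rpow_pos_of_pos (hpos t ht x (Ioc_subset_Icc_self hx)) _).le
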